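/- arXiv:2407.19341 — 2 statements merged into one kernel-verified Lean document; each statement's English description precedes it below -/
import Mathlib

section
/- For every finite simple graph G with m edges, λ₁² ≤ 2m·(1 − 1/ω(G)), where λ₁ is the largest eigenvalue of the adjacency matrix of G and ω(G) is the clique number of G. -/
/-- The adjacency matrix of a simple graph over `ℝ` is Hermitian (symmetric). -/
lemma adjMatrix_isHermitian {V : Type*} [Fintype V] (G : SimpleGraph V)
    [DecidableRel G.Adj] : (G.adjMatrix ℝ).IsHermitian := by
  rw [Matrix.IsHermitian, Matrix.conjTranspose_eq_transpose_of_trivial]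
  exact G.isSymm_adjMatrix

open Finset Matrix in
lemma motzkin_straus_aux {V : Type*} [Fintype V] [DecidableEq V]
    (G : SimpleGraph V) [DecidableRel G.Adj] (k : ℕ) :
    ∀ y : V → ℝ, (∀ i, 0 ≤ y i) → (univ.filter (fun i => y i ≠ 0)).card = k →
      y ⬝ᵥ (G.adjMatrix ℝ *ᵥ y) ≤ (1 - 1 / (G.cliqueNum : ℝ)) * (∑ i, y i) ^ 2 := by
  induction k using Nat.strong_induction_on with
  | _ k ih =>
  intro y hy hk
  by_cases hc : G.IsClique (univ.filter (fun i => y i ≠ 0) : Finset V)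
  · have hle := hc.card_le_cliqueNum
    rw [hk] at hle
    have hF : y ⬝ᵥ (G.adjMatrix ℝ *ᵥ y) = (∑ i, y i) ^ 2 - ∑ i, y i ^ 2 := by
      have : ∀ i j, y i * (G.adjMatrix ℝ i j * y j) = y i * y j - if i = j then y i ^ 2 else 0 := by
        intro i j
        by_cases hij : i = j
        · subst hij; simp; ring
        · by_cases hi : y i = 0
          · simp [hi]
          by_cases hj : y j = 0
          · simp [hj, hij]
          have : G.Adj i j := hc (by simpa using hi) (by simpa using hj) hij
          simp [this, hij]
      simp only [dotProduct, mulVec, Finset.mul_sum, this, Finset.sum_sub_distrib]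
      simp [sq, Finset.sum_mul_sum]
    have hcs : (∑ i, y i) ^ 2 ≤ k * ∑ i, y i ^ 2 := by
      have h := sq_sum_le_card_mul_sum_sq (s := univ.filter (fun i => y i ≠ 0)) (f := y)
      rw [hk, Finset.sum_filter_ne_zero] at h
      refine h.trans ?_
      gcongr
      exact Finset.filter_subset _ _
    have hq : 0 ≤ ∑ i, y i ^ 2 := Finset.sum_nonneg fun i _ => sq_nonneg _
    rw [hF]
    rcases Nat.eq_zero_or_pos G.cliqueNum with h0 | h0
    · rw [h0]; simp; exact hq
    have h0' : (0:ℝ) < G.cliqueNum := by exact_mod_cast h0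
    have hle' : (k:ℝ) ≤ G.cliqueNum := by exact_mod_cast hle
    have : 1 / (G.cliqueNum : ℝ) * (∑ i, y i) ^ 2 ≤ ∑ i, y i ^ 2 := by
      rw [one_div, inv_mul_le_iff₀ h0']
      exact hcs.trans (by gcongr)
    linarith
  · have hex : ∃ u v, y u ≠ 0 ∧ y v ≠ 0 ∧ u ≠ v ∧ ¬ G.Adj u v ∧
        (G.adjMatrix ℝ *ᵥ y) v ≤ (G.adjMatrix ℝ *ᵥ y) u := by
      simp only [SimpleGraph.IsClique, Set.Pairwise] at hc
      push Not at hc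
      obtain ⟨u, hu, v, hv, huv, hadj⟩ := hc
      simp at hu hv
      rcases le_total ((G.adjMatrix ℝ *ᵥ y) v) ((G.adjMatrix ℝ *ᵥ y) u) with h | h
      · exact ⟨u, v, hu, hv, huv, hadj, h⟩
      · exact ⟨v, u, hv, hu, huv.symm, fun h => hadj h.symm, h⟩
    obtain ⟨u, v, hu, hv, huv, hadj, hge⟩ := hex
    set z : V → ℝ := Pi.single u (y v) - Pi.single v (y v) with hz
    have hadj' : ¬ G.Adj v u := fun h => hadj h.symm
    have hzz : z ⬝ᵥ (G.adjMatrix ℝ *ᵥ z) = 0 := by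
      simp [hz, Matrix.mulVec_sub, hadj, hadj', sub_dotProduct]
    have hzy : z ⬝ᵥ (G.adjMatrix ℝ *ᵥ y) =
        y v * ((G.adjMatrix ℝ *ᵥ y) u - (G.adjMatrix ℝ *ᵥ y) v) := by
      rw [hz, sub_dotProduct, single_dotProduct, single_dotProduct]; ring
    have hyz : y ⬝ᵥ (G.adjMatrix ℝ *ᵥ z) = z ⬝ᵥ (G.adjMatrix ℝ *ᵥ y) := by
      rw [dotProduct_mulVec, ← mulVec_transpose, G.isSymm_adjMatrix.eq, dotProduct_comm]
    have hF : y ⬝ᵥ (G.adjMatrix ℝ *ᵥ y) ≤ (y + z) ⬝ᵥ (G.adjMatrix ℝ *ᵥ (y + z)) := by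
      rw [mulVec_add, add_dotProduct, dotProduct_add, dotProduct_add, hzz, hyz, hzy]
      have := mul_nonneg (hy v) (sub_nonneg.2 hge)
      linarith
    have hsum : ∑ i, (y + z) i = ∑ i, y i := by
      simp [hz, Finset.sum_add_distrib]
    have hv0 : (y + z) v = 0 := by simp [hz, huv.symm]
    have hother : ∀ i, i ≠ u → i ≠ v → (y + z) i = y i := by
      intro i h1 h2; simp [hz, h1, h2]
    have hu0 : (y + z) u = y u + y v := by simp [hz, huv]
    have hnn : ∀ i, 0 ≤ (y + z) i := by
      intro i
      by_cases h2 : i = v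
      · rw [h2, hv0]
      by_cases h1 : i = u
      · rw [h1, hu0]; exact add_nonneg (hy _) (hy _)
      rw [hother i h1 h2]; exact hy i
    have hlt : (univ.filter (fun i => (y + z) i ≠ 0)).card < k := by
      rw [← hk]
      apply Finset.card_lt_card
      refine (Finset.ssubset_iff_of_subset ?_).2 ⟨v, by simpa using hv, by simpa using hv0⟩
      intro i hi
      rw [Finset.mem_filter] at hi ⊢
      refine ⟨Finset.mem_univ _, ?_⟩
      by_cases h2 : i = v
      · rw [h2]; exact hv
      by_cases h1 : i = u
      · rw [h1]; exact hu
      rw [← hother i h1 h2]; exact hi.2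
    have := ih _ hlt (y + z) hnn rfl
    rw [hsum] at this
    exact hF.trans this

open Finset Matrix in
lemma eig_sq_le {V : Type*} [Fintype V] [DecidableEq V]
    (G : SimpleGraph V) [DecidableRel G.Adj] (x : V → ℝ) (l : ℝ)
    (hx : ∑ i, x i ^ 2 = 1) (hl : G.adjMatrix ℝ *ᵥ x = l • x) :
    l ^ 2 ≤ 2 * (G.edgeFinset.card : ℝ) * (1 - 1 / (G.cliqueNum : ℝ)) := by
  have h1 : l = ∑ p : V × V, G.adjMatrix ℝ p.1 p.2 * (G.adjMatrix ℝ p.1 p.2 * (x p.1 * x p.2)) := by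
    have h : x ⬝ᵥ (G.adjMatrix ℝ *ᵥ x) = l := by
      rw [hl, dotProduct_smul, dotProduct]
      simp only [← sq, hx]; simp
    rw [← h, Fintype.sum_prod_type]
    simp only [dotProduct, mulVec, Finset.mul_sum]
    refine Finset.sum_congr rfl fun i _ => Finset.sum_congr rfl fun j _ => ?_
    by_cases hh : G.Adj i j <;> simp [hh]
  have h2 : ∑ p : V × V, G.adjMatrix ℝ p.1 p.2 ^ 2 = 2 * (G.edgeFinset.card : ℝ) := by
    have h := G.sum_degrees_eq_twice_card_edges
    have h' : (∑ v, (G.degree v : ℝ)) = 2 * (G.edgeFinset.card : ℝ) := by exact_mod_cast h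
    rw [← h', Fintype.sum_prod_type]
    refine Finset.sum_congr rfl fun i _ => ?_
    simp [SimpleGraph.adjMatrix_apply, ite_pow, ← SimpleGraph.card_neighborFinset_eq_degree,
      SimpleGraph.neighborFinset_eq_filter]
  have h3 : ∑ p : V × V, (G.adjMatrix ℝ p.1 p.2 * (x p.1 * x p.2)) ^ 2 ≤
      (1 - 1 / (G.cliqueNum : ℝ)) := by
    have h := motzkin_straus_aux G _ (fun i => x i ^ 2) (fun i => sq_nonneg _) rfl
    rw [hx] at h
    simp only [one_pow, mul_one] at h
    refine le_of_eq_of_le ?_ h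
    rw [Fintype.sum_prod_type]
    simp only [dotProduct, mulVec, Finset.mul_sum]
    refine Finset.sum_congr rfl fun i _ => Finset.sum_congr rfl fun j _ => ?_
    by_cases hh : G.Adj i j <;> simp [hh, mul_pow]
  have h4 := Finset.sum_mul_sq_le_sq_mul_sq (univ : Finset (V × V))
    (fun p => G.adjMatrix ℝ p.1 p.2) (fun p => G.adjMatrix ℝ p.1 p.2 * (x p.1 * x p.2))
  rw [← h1, h2] at h4
  exact h4.trans (by gcongr)

/-- **Theorem (Nikiforov's spectral Turán theorem).** For every finite simple graph `G`
with `m` edges, `λ₁² ≤ 2m(1 − 1/ω(G))`, where `λ₁ = μ 0` is the largest eigenvalue of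
the adjacency matrix (`μ` lists the eigenvalues in non-increasing order) and `ω(G)` is
the clique number. -/
theorem stmt_13 {V : Type*} [Fintype V] [DecidableEq V] [Nonempty V]
    (G : SimpleGraph V) [DecidableRel G.Adj]
    (m : ℕ) (hm : G.edgeFinset.card = m)
    (μ : Fin (Fintype.card V) → ℝ) (hanti : Antitone μ)
    (hμ : ∃ e : V ≃ Fin (Fintype.card V),
      ∀ v, (adjMatrix_isHermitian G).eigenvalues v = μ (e v)) :
    μ ⟨0, Fintype.card_pos⟩ ^ 2 ≤ 2 * (m : ℝ) * (1 - 1 / (G.cliqueNum : ℝ)) := by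
  obtain ⟨e, he⟩ := hμ
  set v := e.symm ⟨0, Fintype.card_pos⟩ with hv
  have h0 : (adjMatrix_isHermitian G).eigenvalues v = μ ⟨0, Fintype.card_pos⟩ := by
    rw [he, hv, Equiv.apply_symm_apply]
  rw [← h0, ← hm]
  refine eig_sq_le G ((adjMatrix_isHermitian G).eigenvectorBasis v) _ ?_
    ((adjMatrix_isHermitian G).mulVec_eigenvectorBasis v)
  have hn := (adjMatrix_isHermitian G).eigenvectorBasis.orthonormal.1 v
  have := EuclideanSpace.real_norm_sq_eq ((adjMatrix_isHermitian G).eigenvectorBasis v)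
  rw [hn] at this
  simpa using this.symm
end

section
/- Let G be a finite simple graph with m edges. For any integer k with 1 ≤ k ≤ n⁺, the sum of cubes of the k largest eigenvalues satisfies Σ_{i=1}^{k} λ_i³ ≥ (1/√k)·(s_k(G))^(3/2), and the sum of cubes of the absolute values of the negative eigenvalues satisfies Σ_{i: λ_i < 0} |λ_i|³ ≤ (2m − s_k(G))^(3/2). -/
lemma trace_sq_eigs {n : Type*} [Fintype n] [DecidableEq n] (A : Matrix n n ℝ)
    (hA : A.IsHermitian) : (A * A).trace = ∑ i, hA.eigenvalues i ^ 2 := by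
  conv_lhs => rw [hA.spectral_theorem, ← map_mul, Unitary.conjStarAlgAut_apply,
    Matrix.trace_mul_comm, ← mul_assoc]
  simp [Matrix.diagonal_mul_diagonal, Matrix.trace_diagonal, pow_two]

/-- **Lemma (cube-sum estimates).** Let `G` have `m` edges and eigenvalues
`μ 0 ≥ μ 1 ≥ ⋯` of its adjacency matrix with `n⁺` of them positive. For any integer `k`
with `1 ≤ k ≤ n⁺`: the sum of cubes of the `k` largest eigenvalues is at least
`(1/√k)·(s_k)^(3/2)`, and the sum of cubes of absolute values of the negative
eigenvalues is at most `(2m − s_k)^(3/2)`, where `s_k = ∑_{i<k} μ i ^ 2`. -/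
theorem stmt_14 {V : Type*} [Fintype V] [DecidableEq V]
    (G : SimpleGraph V) [DecidableRel G.Adj]
    (m : ℕ) (hm : G.edgeFinset.card = m)
    (μ : Fin (Fintype.card V) → ℝ) (hanti : Antitone μ)
    (hμ : ∃ e : V ≃ Fin (Fintype.card V),
      ∀ v, (adjMatrix_isHermitian G).eigenvalues v = μ (e v))
    (k : ℕ) (hk1 : 1 ≤ k)
    (hk2 : k ≤ (Finset.univ.filter fun i => 0 < μ i).card) :
    (∑ i ∈ Finset.univ.filter (fun i : Fin (Fintype.card V) => (i : ℕ) < k), μ i ^ 3)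
        ≥ (1 / Real.sqrt k) *
          (∑ i ∈ Finset.univ.filter (fun i : Fin (Fintype.card V) => (i : ℕ) < k),
            μ i ^ 2) ^ ((3 : ℝ) / 2) ∧
      (∑ i ∈ Finset.univ.filter (fun i : Fin (Fintype.card V) => μ i < 0), |μ i| ^ 3)
        ≤ (2 * (m : ℝ) -
            ∑ i ∈ Finset.univ.filter (fun i : Fin (Fintype.card V) => (i : ℕ) < k),
              μ i ^ 2) ^ ((3 : ℝ) / 2) := by
  have hsum : ∑ i, μ i ^ 2 = 2 * (m : ℝ) := by
    obtain ⟨e, he⟩ := hμ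
    rw [← Equiv.sum_comp e]
    simp only [← he]
    rw [← trace_sq_eigs, Matrix.trace]
    simp only [Matrix.diag_apply, SimpleGraph.adjMatrix_mul_self_apply_self]
    rw [← hm]
    exact_mod_cast G.sum_degrees_eq_twice_card_edges
  have hpos : ∀ i : Fin (Fintype.card V), (i : ℕ) < k → 0 < μ i := by
    intro i hi
    by_contra hneg
    have hsub : (Finset.univ.filter fun j => 0 < μ j) ⊆ Finset.Iio i := by
      intro j hj
      rw [Finset.mem_filter] at hj
      rw [Finset.mem_Iio]
      by_contra hji
      exact hneg (hj.2.trans_le (hanti (not_lt.mp hji)))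
    have := Finset.card_le_card hsub
    rw [Fin.card_Iio] at this
    omega
  have hkn : k ≤ Fintype.card V := by
    refine hk2.trans ((Finset.card_le_univ _).trans ?_)
    simp
  have hcard : (Finset.univ.filter (fun i : Fin (Fintype.card V) => (i : ℕ) < k)).card = k := by
    rw [Fin.card_filter_val_lt]
    omega
  constructor
  · have h := Real.rpow_sum_le_const_mul_sum_rpow_of_nonneg
      (Finset.univ.filter (fun i : Fin (Fintype.card V) => (i : ℕ) < k))
      (f := fun i => μ i ^ 2) (p := (3 : ℝ) / 2) (by norm_num) (fun i _ => sq_nonneg _)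
    rw [hcard] at h
    have h3 : ∀ i ∈ Finset.univ.filter (fun i : Fin (Fintype.card V) => (i : ℕ) < k),
        (μ i ^ 2) ^ ((3 : ℝ) / 2) = μ i ^ 3 := by
      intro i hi
      have hi' := hpos i (Finset.mem_filter.mp hi).2
      rw [← Real.rpow_natCast, ← Real.rpow_mul hi'.le, ← Real.rpow_natCast]
      norm_num
    rw [Finset.sum_congr rfl h3] at h
    have hk : (0 : ℝ) < Real.sqrt k := Real.sqrt_pos.mpr (by exact_mod_cast hk1)
    have he : (k : ℝ) ^ ((3 : ℝ) / 2 - 1) = Real.sqrt k := by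
      rw [Real.sqrt_eq_rpow]
      norm_num
    rw [he] at h
    rw [ge_iff_le, one_div, inv_mul_le_iff₀ hk]
    exact h
  · have hS : ∑ i ∈ Finset.univ.filter (fun i : Fin (Fintype.card V) => μ i < 0), μ i ^ 2 ≤
        2 * (m : ℝ) - ∑ i ∈ Finset.univ.filter
          (fun i : Fin (Fintype.card V) => (i : ℕ) < k), μ i ^ 2 := by
      rw [← hsum, le_sub_iff_add_le, ← Finset.sum_union]
      · exact Finset.sum_le_sum_of_subset_of_nonneg (Finset.subset_univ _)
          (fun i _ _ => sq_nonneg _)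
      · rw [Finset.disjoint_left]
        intro i hi hi'
        exact absurd (hpos i (Finset.mem_filter.mp hi').2)
          (not_lt.mpr (Finset.mem_filter.mp hi).2.le)
    generalize 2 * (m : ℝ) - ∑ i ∈ Finset.univ.filter
          (fun i : Fin (Fintype.card V) => (i : ℕ) < k), μ i ^ 2 = T at hS
    have hT : 0 ≤ T := (Finset.sum_nonneg (fun i _ => sq_nonneg _)).trans hS
    have hTe : T ^ ((3 : ℝ) / 2) = Real.sqrt T * T := by
      rw [Real.sqrt_eq_rpow, ← Real.rpow_add_one' hT (by norm_num)]
      norm_num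
    rw [hTe]
    refine le_trans ?_ (mul_le_mul_of_nonneg_left hS (Real.sqrt_nonneg T))
    rw [Finset.mul_sum]
    refine Finset.sum_le_sum fun i hi => ?_
    have h1 : |μ i| ≤ Real.sqrt T := by
      apply Real.abs_le_sqrt
      exact (Finset.single_le_sum (f := fun i => μ i ^ 2) (fun i _ => sq_nonneg _) hi).trans hS
    rw [pow_succ', sq_abs]
    exact mul_le_mul_of_nonneg_right h1 (sq_nonneg _)
end
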